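/- arXiv:2308.06363 — 7 statements merged into one kernel-verified Lean document; each statement's English description precedes it below -/
import Mathlib

section
/- Let p be an odd prime and let f : ℤ_p → ℚ_p be a continuous function (natural numbers are regarded as elements of ℤ_p via the canonical map). If the sequence N ↦ Σ_{x=0}^{p^N − 1} (−1)^x f(x) converges in ℚ_p to a limit I, then the sequence N ↦ Σ_{x=0}^{p^N − 1} (−1)^x f(x + 1) converges to 2 f(0) − I. Equivalently, the fermionic p-adic integral I_{−1}(f) = lim_{N→∞} Σ_{x=0}^{p^N−1} (−1)^x f(x) satisfies I_{−1}(f₁) + I_{−1}(f) = 2 f(0), where f₁(x) = f(x + 1). -/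
/-- An alternating sum and its shift by one telescope to the two boundary terms. -/
theorem sum_range_neg_one_pow_mul_succ_add {R : Type*} [CommRing R] (g : ℕ → R) (n : ℕ) :
    ∑ x ∈ Finset.range n, (-1) ^ x * g (x + 1) + ∑ x ∈ Finset.range n, (-1) ^ x * g x =
      g 0 - (-1) ^ n * g n := by
  induction n with
  | zero => simp
  | succ n ih =>
    rw [Finset.sum_range_succ, Finset.sum_range_succ, pow_succ]
    linear_combination ih


/-- For an odd prime `p` and a continuous `f : ℤ_p → ℚ_p`, if the fermionic sums
`Σ_{x=0}^{p^N − 1} (−1)^x f(x)` converge to `I`, then the sums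
`Σ_{x=0}^{p^N − 1} (−1)^x f(x + 1)` converge to `2 f(0) − I`; that is,
`I_{−1}(f₁) + I_{−1}(f) = 2 f(0)` where `f₁(x) = f(x+1)`. -/
theorem fermionic_padic_integral_shift
    (p : ℕ) [Fact p.Prime] (hodd : Odd p)
    (f : ℤ_[p] → ℚ_[p]) (hf : Continuous f) (I : ℚ_[p])
    (h : Filter.Tendsto
      (fun N : ℕ => ∑ x ∈ Finset.range (p ^ N), (-1 : ℚ_[p]) ^ x * f (x : ℤ_[p]))
      Filter.atTop (nhds I)) :
    Filter.Tendsto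
      (fun N : ℕ => ∑ x ∈ Finset.range (p ^ N), (-1 : ℚ_[p]) ^ x * f ((x : ℤ_[p]) + 1))
      Filter.atTop (nhds (2 * f 0 - I)) := by
  have hp : Filter.Tendsto (fun N : ℕ => ((p ^ N : ℕ) : ℤ_[p])) Filter.atTop (nhds 0) := by
    simp only [Nat.cast_pow]
    exact tendsto_pow_atTop_nhds_zero_of_norm_lt_one (by
      rw [PadicInt.norm_p]
      exact inv_lt_one_of_one_lt₀ (by exact_mod_cast (Fact.out : p.Prime).one_lt))
  have hfp := ((hf.tendsto 0).comp hp).const_add (f 0)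
  rw [← two_mul] at hfp
  refine (hfp.sub h).congr fun N => ?_
  have key := sum_range_neg_one_pow_mul_succ_add (fun x : ℕ => f (x : ℤ_[p])) (p ^ N)
  simp only [Nat.cast_add, Nat.cast_one, Nat.cast_zero, (hodd.pow (n := N)).neg_one_pow] at key
  simp only [Function.comp_apply]
  linear_combination -key
end

section
/- Let p be an odd prime, r a natural number, and q ∈ ℤ_p with ‖q − 1‖_p < 1 and q ≠ 1. Then in ℚ_p the fermionic q-Volkenborn integral of [x]_q^r exists and equals the stated closed form: lim_{N→∞} (1 + q)/(1 + q^{p^N}) · Σ_{x=0}^{p^N − 1} (−q)^x ((1 − q^x)/(1 − q))^r = (1 + q) · (1/(1 − q))^r · Σ_{l=0}^{r} C(r,l) (−1)^l / (1 + q^{l+1}), where C(r,l) is the binomial coefficient. (Note that ‖q − 1‖_p < 1 forces 1 + q^{m} to be a p-adic unit for every m ≥ 0, so all denominators are nonzero, and q^{p^N} → 1 as N → ∞.) -/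
theorem PadicInt.one_add_pow_coe_ne_zero {p : ℕ} [Fact p.Prime] (hodd : Odd p) {q : ℤ_[p]}
    (hq1 : ‖q - 1‖ < 1) (m : ℕ) : 1 + (q : ℚ_[p]) ^ m ≠ 0 := by
  intro h
  have h' : 1 + q ^ m = 0 := Subtype.ext (by push_cast; exact h)
  have hdvd : (p : ℤ_[p]) ∣ q ^ m - 1 := by
    have := sub_dvd_pow_sub_pow q 1 m
    rw [one_pow] at this
    exact ((PadicInt.norm_lt_one_iff_dvd _).1 hq1).trans this
  have h2 : (p : ℤ_[p]) ∣ ((2 : ℕ) : ℤ_[p]) := by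
    rw [← dvd_neg]
    convert hdvd using 1
    push_cast
    linear_combination -h'
  have hp2 : p ∣ 2 := by
    have := (PadicInt.norm_lt_one_iff_dvd _).2 h2
    exact PadicInt.norm_natCast_lt_one_iff.1 this
  have := (Nat.prime_dvd_prime_iff_eq (Fact.out : p.Prime) Nat.prime_two).1 hp2
  subst this
  exact absurd hodd (by decide)

theorem PadicInt.tendsto_coe_pow_prime_pow {p : ℕ} [Fact p.Prime] {q : ℤ_[p]}
    (hq1 : ‖q - 1‖ < 1) :
    Filter.Tendsto (fun N : ℕ => (q : ℚ_[p]) ^ p ^ N) Filter.atTop (nhds 1) := by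
  rw [tendsto_iff_norm_sub_tendsto_zero]
  have hp : (1 : ℝ) < p := by exact_mod_cast (Fact.out : p.Prime).one_lt
  refine squeeze_zero (fun _ => norm_nonneg _) (fun N => ?_)
    (tendsto_pow_atTop_nhds_zero_of_lt_one (r := (p : ℝ)⁻¹) (by positivity)
      (inv_lt_one_of_one_lt₀ hp))
  obtain ⟨c, hc⟩ := dvd_sub_pow_of_dvd_sub ((PadicInt.norm_lt_one_iff_dvd _).1 hq1) N
  rw [one_pow] at hc
  have hc' : (q : ℚ_[p]) ^ p ^ N - 1 = ((p : ℚ_[p]) ^ (N + 1)) * c := by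
    simpa using congrArg (fun z : ℤ_[p] => (z : ℚ_[p])) hc
  rw [hc', norm_mul, norm_pow, Padic.norm_p]
  calc ((p : ℝ)⁻¹) ^ (N + 1) * ‖(c : ℚ_[p])‖ ≤ ((p : ℝ)⁻¹) ^ (N + 1) * 1 := by
        gcongr
        exact c.2
    _ ≤ ((p : ℝ)⁻¹) ^ N := by
        rw [mul_one]
        exact pow_le_pow_of_le_one (by positivity) (inv_le_one_of_one_le₀ hp.le) N.le_succ

theorem sum_range_neg_pow_mul_qnumber_pow {K : Type*} [Field K] (q : K) {n : ℕ} (hn : Odd n)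
    (r : ℕ) (hq : ∀ m : ℕ, 1 + q ^ m ≠ 0) :
    ∑ x ∈ Finset.range n, (-q) ^ x * ((1 - q ^ x) / (1 - q)) ^ r =
      (1 / (1 - q)) ^ r * ∑ l ∈ Finset.range (r + 1),
        (r.choose l : K) * (-1) ^ l / (1 + q ^ (l + 1)) * (1 + (q ^ n) ^ (l + 1)) := by
  have hgeom (l : ℕ) : ∑ x ∈ Finset.range n, (-q ^ (l + 1)) ^ x =
      (1 + (q ^ n) ^ (l + 1)) / (1 + q ^ (l + 1)) := by
    rw [eq_div_iff (hq _)]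
    have := geom_sum_mul (-q ^ (l + 1)) n
    rw [hn.neg_pow, ← pow_mul, mul_comm (l + 1) n, pow_mul] at this
    linear_combination -this
  have hterm (x : ℕ) : (-q) ^ x * ((1 - q ^ x) / (1 - q)) ^ r =
      (1 / (1 - q)) ^ r * ∑ l ∈ Finset.range (r + 1),
        (r.choose l : K) * (-1) ^ l * (-q ^ (l + 1)) ^ x := by
    have hb : (1 - q ^ x) ^ r =
        ∑ l ∈ Finset.range (r + 1), (-q ^ x) ^ l * (r.choose l : K) := by
      rw [sub_eq_neg_add, add_pow]
      simp
    rw [div_eq_mul_one_div, mul_pow, hb, mul_comm _ ((1 / (1 - q)) ^ r), mul_left_comm,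
      Finset.mul_sum]
    congr 1
    refine Finset.sum_congr rfl fun l _ => ?_
    rw [neg_pow q, neg_pow (q ^ x), neg_pow (q ^ (l + 1))]
    ring
  simp_rw [hterm]
  rw [← Finset.mul_sum, Finset.sum_comm]
  congr 1
  refine Finset.sum_congr rfl fun l _ => ?_
  rw [← Finset.mul_sum, hgeom]
  ring

/-- For an odd prime `p`, `r : ℕ`, and `q ∈ ℤ_p` with `‖q − 1‖_p < 1` and `q ≠ 1`,
the fermionic `q`-Volkenborn integral of `[x]_q^r` exists and equals
`(1 + q) (1/(1 − q))^r Σ_{l=0}^{r} C(r,l) (−1)^l / (1 + q^{l+1})`. -/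
theorem fermionic_q_volkenborn_qnumber_pow
    (p : ℕ) [Fact p.Prime] (hodd : Odd p) (r : ℕ)
    (q : ℤ_[p]) (hq1 : ‖q - 1‖ < 1) (hq : q ≠ 1) :
    Filter.Tendsto
      (fun N : ℕ =>
        ((1 + (q : ℚ_[p])) / (1 + (q : ℚ_[p]) ^ p ^ N)) *
          ∑ x ∈ Finset.range (p ^ N),
            (-(q : ℚ_[p])) ^ x * ((1 - (q : ℚ_[p]) ^ x) / (1 - (q : ℚ_[p]))) ^ r)
      Filter.atTop
      (nhds ((1 + (q : ℚ_[p])) * (1 / (1 - (q : ℚ_[p]))) ^ r *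
        ∑ l ∈ Finset.range (r + 1),
          (r.choose l : ℚ_[p]) * (-1) ^ l / (1 + (q : ℚ_[p]) ^ (l + 1)))) := by
  have hne := PadicInt.one_add_pow_coe_ne_zero hodd hq1
  have ht := PadicInt.tendsto_coe_pow_prime_pow hq1
  have h2 : (1 : ℚ_[p]) + 1 ≠ 0 := by norm_num
  simp_rw [sum_range_neg_pow_mul_qnumber_pow (q : ℚ_[p]) hodd.pow r hne]
  have hlim := ((tendsto_const_nhds (x := 1 + (q : ℚ_[p]))).div (ht.const_add 1) h2).mul
    ((tendsto_finsetSum (Finset.range (r + 1)) fun l _ =>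
      ((ht.pow (l + 1)).const_add 1).const_mul
        ((r.choose l : ℚ_[p]) * (-1) ^ l / (1 + (q : ℚ_[p]) ^ (l + 1)))).const_mul
      ((1 / (1 - (q : ℚ_[p]))) ^ r))
  convert hlim using 2
  · rfl
  simp_rw [one_pow]
  rw [← Finset.sum_mul]
  field_simp
end

section
/- Let p be a prime, K a field, and ρ, q nonzero elements of K with ρ ≠ q. Let N ≥ 0 and a be natural numbers, and assume ρ^{p^N} ≠ q^{p^N} and ρ^{p^{N+1}} ≠ q^{p^{N+1}}. Then Σ_{i=0}^{p−1} [ρ^{p^{N+1}} (ρ − q)/(ρ^{p^{N+1}} − q^{p^{N+1}})] · (q/ρ)^{a + i p^N} = [ρ^{p^N} (ρ − q)/(ρ^{p^N} − q^{p^N})] · (q/ρ)^{a}. (That is, the (ρ,q)-Volkenborn measure μ_{ρ,q}(a + p^N ℤ_p) = (ρ^{p^N}/[p^N]_{ρ,q}) (q/ρ)^a satisfies the distribution relation Σ_{i=0}^{p−1} μ_{ρ,q}(a + i p^N + p^{N+1} ℤ_p) = μ_{ρ,q}(a + p^N ℤ_p).) -/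
/-- The `(ρ,q)`-Volkenborn measure `μ_{ρ,q}(a + p^N ℤ_p) = (ρ^{p^N}/[p^N]_{ρ,q}) (q/ρ)^a`,
where `[n]_{ρ,q} = (ρⁿ − qⁿ)/(ρ − q)`, satisfies the distribution relation
`Σ_{i=0}^{p−1} μ_{ρ,q}(a + i p^N + p^{N+1} ℤ_p) = μ_{ρ,q}(a + p^N ℤ_p)`. -/
theorem rho_q_volkenborn_measure_distribution_relation
    (p : ℕ) (hp : p.Prime) (K : Type*) [Field K] (ρ q : K)
    (hρ0 : ρ ≠ 0) (hq0 : q ≠ 0) (hρq : ρ ≠ q) (N a : ℕ)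
    (h1 : ρ ^ p ^ N ≠ q ^ p ^ N) (h2 : ρ ^ p ^ (N + 1) ≠ q ^ p ^ (N + 1)) :
    ∑ i ∈ Finset.range p,
        ρ ^ p ^ (N + 1) * (ρ - q) / (ρ ^ p ^ (N + 1) - q ^ p ^ (N + 1)) *
          (q / ρ) ^ (a + i * p ^ N) =
      ρ ^ p ^ N * (ρ - q) / (ρ ^ p ^ N - q ^ p ^ N) * (q / ρ) ^ a := by
  have hR : ρ ^ p ^ N ≠ 0 := pow_ne_zero _ hρ0
  simp only [pow_add, mul_comm _ (p ^ N), pow_mul, div_pow, pow_one] at h2 ⊢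
  generalize ρ ^ p ^ N = R at *
  generalize q ^ p ^ N = Q at *
  have hx : Q / R ≠ 1 := fun h => h1 ((div_eq_one_iff_eq hR).mp h).symm
  have hgeom : ∑ i ∈ Finset.range p, Q ^ i / R ^ i = (Q ^ p / R ^ p - 1) / (Q / R - 1) := by
    simpa only [div_pow] using geom_sum_eq hx p
  rw [← Finset.mul_sum, ← Finset.mul_sum, hgeom]
  have hd : R - Q ≠ 0 := sub_ne_zero.mpr h1
  have hd' : Q - R ≠ 0 := sub_ne_zero.mpr h1.symm
  have hdp : R ^ p - Q ^ p ≠ 0 := sub_ne_zero.mpr h2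
  rw [div_sub_one hR, div_sub_one (pow_ne_zero p hR)]
  field_simp
  ring
end

section
/- Let p, q be real numbers with 0 < q < p, let f : ℝ → ℝ, and let z ≠ 0. Assume the series Σ_{k=0}^{∞} (q/p)^k f((q/p)^k z) converges. For w ∈ ℝ for which the series converges, define the (p,q)-antiderivative F(w) = (p − q) w Σ_{k=0}^{∞} (q^k / p^{k+1}) f((q^k / p^{k+1}) w). Then the series defining F(pz) and F(qz) both converge, and the (p,q)-derivative of F at z recovers f: (F(pz) − F(qz))/((p − q) z) = f(z). -/
/-- For `0 < q < p`, `z ≠ 0`, and `f : ℝ → ℝ` such that the series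
`Σ_k (q/p)^k f((q/p)^k z)` converges, the series defining the `(p,q)`-antiderivative
`F(w) = (p − q) w Σ_k (q^k/p^{k+1}) f((q^k/p^{k+1}) w)` at `w = pz` and `w = qz` both
converge, and the `(p,q)`-derivative of `F` at `z` recovers `f`:
`(F(pz) − F(qz))/((p − q) z) = f(z)`. -/
theorem pq_integral_fundamental_theorem
    (p q : ℝ) (hq : 0 < q) (hpq : q < p) (f : ℝ → ℝ) (z : ℝ) (hz : z ≠ 0)
    (h : Summable fun k : ℕ => (q / p) ^ k * f ((q / p) ^ k * z)) :
    (Summable fun k : ℕ => q ^ k / p ^ (k + 1) * f (q ^ k / p ^ (k + 1) * (p * z))) ∧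
    (Summable fun k : ℕ => q ^ k / p ^ (k + 1) * f (q ^ k / p ^ (k + 1) * (q * z))) ∧
    ((p - q) * (p * z) *
        (∑' k : ℕ, q ^ k / p ^ (k + 1) * f (q ^ k / p ^ (k + 1) * (p * z))) -
      (p - q) * (q * z) *
        (∑' k : ℕ, q ^ k / p ^ (k + 1) * f (q ^ k / p ^ (k + 1) * (q * z)))) /
      ((p - q) * z) = f z := by
  have hp : 0 < p := hq.trans hpq
  set g : ℕ → ℝ := fun k => (q / p) ^ k * f ((q / p) ^ k * z) with hg
  have h_p : (fun k : ℕ => q ^ k / p ^ (k + 1) * f (q ^ k / p ^ (k + 1) * (p * z))) =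
      fun k => p⁻¹ * g k := by
    funext k
    have harg : q ^ k / p ^ (k + 1) * (p * z) = (q / p) ^ k * z := by
      rw [div_pow]
      field_simp
      ring
    rw [harg, hg]
    simp only [div_pow]
    field_simp
    ring
  have h_q : (fun k : ℕ => q ^ k / p ^ (k + 1) * f (q ^ k / p ^ (k + 1) * (q * z))) =
      fun k => q⁻¹ * g (k + 1) := by
    funext k
    have harg : q ^ k / p ^ (k + 1) * (q * z) = (q / p) ^ (k + 1) * z := by
      rw [div_pow]
      field_simp
      ring
    rw [harg, hg]
    simp only [div_pow]
    field_simp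
    ring
  have hshift : Summable fun k => g (k + 1) := (summable_nat_add_iff 1).2 h
  rw [h_p, h_q, tsum_mul_left, tsum_mul_left, h.tsum_eq_zero_add]
  refine ⟨h.mul_left _, hshift.mul_left _, ?_⟩
  have hg0 : g 0 = f z := by simp [hg]
  have hne : p - q ≠ 0 := sub_ne_zero.2 hpq.ne'
  rw [hg0]
  field_simp
  ring
end

section
/- Let K be a field, p, q, a ∈ K with p ≠ q, and let n ≥ 1. Set f(x) = (x ⊖ a)ⁿ_{p,q} = ∏_{i=0}^{n−1} (pⁱ x − qⁱ a). Then for every x ≠ 0, (f(px) − f(qx))/((p − q) x) = [n]_{p,q} · ∏_{i=0}^{n−2} (pⁱ (p x) − qⁱ a); that is, D_{p,q} (x ⊖ a)ⁿ_{p,q} = [n]_{p,q} (p x ⊖ a)^{n−1}_{p,q}. -/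
/-- `(q x ⊖ a)^{m+1}_{p,q} = q^m (q x − a) (p x ⊖ a)^m_{p,q}`. -/
theorem pq_power_basis_succ_mul_left {R : Type*} [CommRing R] (p q a x : R) (m : ℕ) :
    ∏ i ∈ Finset.range (m + 1), (p ^ i * (q * x) - q ^ i * a) =
      q ^ m * (q * x - a) * ∏ i ∈ Finset.range m, (p ^ i * (p * x) - q ^ i * a) := by
  induction m with
  | zero => simp
  | succ m ih =>
    rw [Finset.prod_range_succ, ih, Finset.prod_range_succ _ m]
    ring

/-- `D_{p,q} (x ⊖ a)ⁿ_{p,q} = [n]_{p,q} (p x ⊖ a)^{n−1}_{p,q}`, where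
`(x ⊖ a)ⁿ_{p,q} = ∏_{i=0}^{n−1} (pⁱ x − qⁱ a)`, `[n]_{p,q} = (pⁿ − qⁿ)/(p − q)`, and
`(D_{p,q}f)(x) = (f(px) − f(qx))/((p − q)x)` for `x ≠ 0`. -/
theorem pq_derivative_power_basis
    (K : Type*) [Field K] (p q a : K) (hpq : p ≠ q) (n : ℕ) (hn : 1 ≤ n) :
    ∀ x : K, x ≠ 0 →
      ((∏ i ∈ Finset.range n, (p ^ i * (p * x) - q ^ i * a)) -
          ∏ i ∈ Finset.range n, (p ^ i * (q * x) - q ^ i * a)) / ((p - q) * x) =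
        (p ^ n - q ^ n) / (p - q) *
          ∏ i ∈ Finset.range (n - 1), (p ^ i * (p * x) - q ^ i * a) := by
  intro x hx
  obtain ⟨m, rfl⟩ := Nat.exists_eq_add_of_le' hn
  have hpq' : p - q ≠ 0 := sub_ne_zero.mpr hpq
  rw [pq_power_basis_succ_mul_left, Finset.prod_range_succ, Nat.add_sub_cancel]
  rw [div_mul_eq_mul_div, div_eq_div_iff (mul_ne_zero hpq' hx) hpq']
  ring
end

section
/- Let K be a field and p, q nonzero elements of K with p^j ≠ q^j for 1 ≤ j ≤ n. Let a ∈ K and 0 ≤ k ≤ n. Then, as an identity of polynomials in K[X], D_{p,q}^k ((X ⊖ a)ⁿ_{p,q}) = p^{k(k−1)/2} · ([n]!_{p,q} / [n−k]!_{p,q}) · ∏_{i=0}^{n−k−1} (pⁱ (p^k X) − qⁱ a), i.e. D_{p,q}^k (x ⊖ a)ⁿ_{p,q} = p^{k(k−1)/2} ([n]!_{p,q}/[n−k]!_{p,q}) (p^k x ⊖ a)^{n−k}_{p,q}. -/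
open Polynomial

/-- The `(p,q)`-number `[n]_{p,q} = (pⁿ − qⁿ)/(p − q)`. -/
noncomputable def pqNum {K : Type*} [Field K] (p q : K) (n : ℕ) : K :=
  (p ^ n - q ^ n) / (p - q)

/-- The `(p,q)`-factorial `[n]!_{p,q} = ∏_{j=1}^{n} [j]_{p,q}`. -/
noncomputable def pqFactorial {K : Type*} [Field K] (p q : K) (n : ℕ) : K :=
  ∏ j ∈ Finset.range n, pqNum p q (j + 1)

/-- The `(p,q)`-derivative on `K[X]`: the `K`-linear operation with
`D_{p,q}(Xⁿ) = [n]_{p,q} X^{n−1}` and `D_{p,q}(1) = 0`; equivalently, for `z ≠ 0`,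
`(D_{p,q}f)(z) = (f(pz) − f(qz))/((p − q)z)`. -/
noncomputable def pqDeriv {K : Type*} [Field K] (p q : K) (f : Polynomial K) : Polynomial K :=
  Polynomial.C (p - q)⁻¹ * (f.comp (Polynomial.C p * Polynomial.X) -
    f.comp (Polynomial.C q * Polynomial.X)).divX

/-- `f(px) - f(qx)` for `f(x) = (b x ⊖ a)^{m+1}_{p,q}`. -/
theorem pq_comp_sub_comp_power_basis {K : Type*} [Field K] (p q a b : K) (m : ℕ) :
    (∏ i ∈ Finset.range (m + 1), (C (p ^ i) * (C b * X) - C (q ^ i * a))).comp (C p * X) -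
      (∏ i ∈ Finset.range (m + 1), (C (p ^ i) * (C b * X) - C (q ^ i * a))).comp (C q * X) =
    C ((p ^ (m + 1) - q ^ (m + 1)) * b) *
      (∏ i ∈ Finset.range m, (C (p ^ i) * (C (p * b) * X) - C (q ^ i * a))) * X := by
  have h_p : ∀ i : ℕ, C (p ^ i) * (C b * (C p * X)) - C (q ^ i * a) =
      C (p ^ i) * (C (p * b) * X) - C (q ^ i * a) := by
    intro i
    simp only [C_mul]
    ring
  have h_q : ∀ i : ℕ, C (p ^ (i + 1)) * (C b * (C q * X)) - C (q ^ (i + 1) * a) =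
      C q * (C (p ^ i) * (C (p * b) * X) - C (q ^ i * a)) := by
    intro i
    simp only [C_mul, pow_succ]
    ring
  simp only [prod_comp, sub_comp, mul_comp, C_comp, X_comp]
  rw [Finset.prod_range_succ, Finset.prod_range_succ']
  simp only [h_p, h_q, Finset.prod_mul_distrib, Finset.prod_const, Finset.card_range]
  simp only [C_mul, C_pow, C_sub, pow_zero, C_1]
  ring

/-- `D_{p,q} (b x ⊖ a)^{m+1}_{p,q} = [m+1]_{p,q} b (p b x ⊖ a)^m_{p,q}`. -/
theorem pqDeriv_power_basis {K : Type*} [Field K] (p q a b c : K) (m : ℕ) :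
    pqDeriv p q
        (C c * ∏ i ∈ Finset.range (m + 1), (C (p ^ i) * (C b * X) - C (q ^ i * a))) =
      C (c * (pqNum p q (m + 1) * b)) *
        ∏ i ∈ Finset.range m, (C (p ^ i) * (C (p * b) * X) - C (q ^ i * a)) := by
  have h_divX : ∀ f : K[X], (f * X).divX = f := fun f => by
    ext i
    rw [coeff_divX, coeff_mul_X]
  rw [pqDeriv, mul_comp, mul_comp, C_comp, C_comp, ← mul_sub, pq_comp_sub_comp_power_basis,
    ← mul_assoc, h_divX, pqNum, div_eq_mul_inv]
  simp only [C_mul]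
  ring

theorem pqFactorial_succ {K : Type*} [Field K] (p q : K) (n : ℕ) :
    pqFactorial p q (n + 1) = pqFactorial p q n * pqNum p q (n + 1) :=
  Finset.prod_range_succ _ _

theorem pqFactorial_ne_zero {K : Type*} [Field K] {p q : K} {n : ℕ}
    (hpq : ∀ j : ℕ, 1 ≤ j → j ≤ n → p ^ j ≠ q ^ j) : pqFactorial p q n ≠ 0 := by
  refine Finset.prod_ne_zero_iff.mpr fun j hj => ?_
  have h_lt := Finset.mem_range.mp hj
  have h_one : p ≠ q := by simpa using hpq 1 le_rfl (by omega)
  exact div_ne_zero (sub_ne_zero.mpr (hpq (j + 1) (by omega) (by omega)))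
    (sub_ne_zero.mpr h_one)

/-- `D_{p,q}^k (x ⊖ a)ⁿ_{p,q}
  = p^{k(k−1)/2} ([n]!_{p,q}/[n−k]!_{p,q}) (p^k x ⊖ a)^{n−k}_{p,q}`
as an identity of polynomials in `K[X]`. -/
theorem pq_iterated_derivative_power_basis
    (K : Type*) [Field K] (p q : K) (hp : p ≠ 0) (hq : q ≠ 0) (n : ℕ)
    (hpq : ∀ j : ℕ, 1 ≤ j → j ≤ n → p ^ j ≠ q ^ j) (a : K) (k : ℕ) (hk : k ≤ n) :
    (pqDeriv p q)^[k]
        (∏ i ∈ Finset.range n, (C (p ^ i) * X - C (q ^ i * a))) =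
      C (p ^ (k * (k - 1) / 2) * (pqFactorial p q n / pqFactorial p q (n - k))) *
        ∏ i ∈ Finset.range (n - k), (C (p ^ i) * (C (p ^ k) * X) - C (q ^ i * a)) := by
  induction k with
  | zero =>
    have h_fact := pqFactorial_ne_zero hpq
    simp [h_fact]
  | succ k ih =>
    obtain ⟨m, rfl⟩ : ∃ m, n = m + 1 + k := ⟨n - (k + 1), by omega⟩
    have h_fact : pqFactorial p q (m + 1) ≠ 0 :=
      pqFactorial_ne_zero fun j hj hjm => hpq j hj (by omega)
    have h_exp : (k + 1) * (k + 1 - 1) / 2 = k * (k - 1) / 2 + k := by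
      rw [← Finset.sum_range_id_mul_two, ← Finset.sum_range_id_mul_two k,
        Nat.mul_div_cancel _ two_pos, Nat.mul_div_cancel _ two_pos, Finset.sum_range_succ]
    rw [Function.iterate_succ_apply', ih (by omega), Nat.add_sub_cancel,
      show m + 1 + k - (k + 1) = m by omega, pqDeriv_power_basis, ← pow_succ', h_exp]
    rw [pqFactorial_succ] at h_fact
    rw [pqFactorial_succ p q m]
    congr 2
    have h_left := left_ne_zero_of_mul h_fact
    have h_right := right_ne_zero_of_mul h_fact
    field_simp
    ring
end

section
/- Let K be a field and p, q nonzero elements of K with p^j ≠ q^j for 1 ≤ j ≤ n. Let a ∈ K and 0 ≤ k ≤ n. Then, as an identity of polynomials in K[X], D_{p,q}^k ((a ⊖ X)ⁿ_{p,q}) = (−1)^k q^{k(k−1)/2} · ([n]!_{p,q} / [n−k]!_{p,q}) · ∏_{i=0}^{n−k−1} (pⁱ a − qⁱ (q^k X)), i.e. D_{p,q}^k (a ⊖ x)ⁿ_{p,q} = (−1)^k q^{k(k−1)/2} ([n]!_{p,q}/[n−k]!_{p,q}) (a ⊖ q^k x)^{n−k}_{p,q}. -/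
open Polynomial

lemma pqDeriv_C_mul {K : Type*} [Field K] (p q b : K) (f : K[X]) :
    pqDeriv p q (C b * f) = C b * pqDeriv p q f := by
  rw [pqDeriv, pqDeriv, mul_comp, mul_comp, C_comp, C_comp, ← mul_sub, divX_C_mul]
  ring

/-- The `(p,q)`-derivative of `(a ⊖ c x)^{m+1}_{p,q}` is `-c [m+1]_{p,q} (a ⊖ q c x)^m_{p,q}`. -/
lemma pqDeriv_prod_succ {K : Type*} [Field K] (p q a c : K) (m : ℕ) :
    pqDeriv p q (∏ i ∈ Finset.range (m + 1), (C (p ^ i * a) - C (q ^ i) * (C c * X))) =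
      C (-c * pqNum p q (m + 1)) *
        ∏ i ∈ Finset.range m, (C (p ^ i * a) - C (q ^ i) * (C (c * q) * X)) := by
  set Q : K[X] := ∏ i ∈ Finset.range m, (C (p ^ i * a) - C (q ^ i) * (C (c * q) * X)) with hQ
  have hcomp (r : K) :
      (∏ i ∈ Finset.range (m + 1), (C (p ^ i * a) - C (q ^ i) * (C c * X))).comp (C r * X) =
        ∏ i ∈ Finset.range (m + 1), (C (p ^ i * a) - C (q ^ i) * (C c * (C r * X))) := by
    simp only [prod_comp, sub_comp, mul_comp, C_comp, X_comp]
  have hp : ∏ i ∈ Finset.range (m + 1), (C (p ^ i * a) - C (q ^ i) * (C c * (C p * X))) =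
      C (p ^ m) * Q * (C a - C c * (C p * X)) := by
    rw [Finset.prod_range_succ']
    congr 1
    · rw [hQ, C_pow, ← Finset.card_range m, ← Finset.prod_const, Finset.card_range,
        ← Finset.prod_mul_distrib]
      refine Finset.prod_congr rfl fun i _ => ?_
      simp only [C_mul, C_pow]
      ring
    · simp
  have hq : ∏ i ∈ Finset.range (m + 1), (C (p ^ i * a) - C (q ^ i) * (C c * (C q * X))) =
      Q * (C (p ^ m * a) - C (q ^ m) * (C c * (C q * X))) := by
    rw [Finset.prod_range_succ, hQ]
    simp only [C_mul, mul_assoc]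
  have hdiff : C (p ^ m) * Q * (C a - C c * (C p * X)) -
      Q * (C (p ^ m * a) - C (q ^ m) * (C c * (C q * X))) =
        C (-c * (p ^ (m + 1) - q ^ (m + 1))) * Q * X := by
    simp only [C_mul, C_pow, C_neg, C_sub]
    ring
  have hdivX (f : K[X]) : (f * X).divX = f := by
    ext i
    rw [coeff_divX, coeff_mul_X]
  rw [pqDeriv, hcomp, hcomp, hp, hq, hdiff, hdivX, ← mul_assoc, ← C_mul, pqNum]
  congr 2
  ring

lemma pqNum_ne_zero {K : Type*} [Field K] {p q : K} {j : ℕ} (h : p ≠ q)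
    (hj : p ^ j ≠ q ^ j) : pqNum p q j ≠ 0 :=
  div_ne_zero (sub_ne_zero.mpr hj) (sub_ne_zero.mpr h)

/-- `D_{p,q}^k (a ⊖ x)ⁿ_{p,q}
  = (−1)^k q^{k(k−1)/2} ([n]!_{p,q}/[n−k]!_{p,q}) (a ⊖ q^k x)^{n−k}_{p,q}`
as an identity of polynomials in `K[X]`, where
`(a ⊖ x)ⁿ_{p,q} = ∏_{i=0}^{n−1} (pⁱ a − qⁱ x)`. -/
theorem pq_iterated_derivative_power_basis_reversed
    (K : Type*) [Field K] (p q : K) (hp : p ≠ 0) (hq : q ≠ 0) (n : ℕ)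
    (hpq : ∀ j : ℕ, 1 ≤ j → j ≤ n → p ^ j ≠ q ^ j) (a : K) (k : ℕ) (hk : k ≤ n) :
    (pqDeriv p q)^[k]
        (∏ i ∈ Finset.range n, (C (p ^ i * a) - C (q ^ i) * X)) =
      C ((-1) ^ k * q ^ (k * (k - 1) / 2) * (pqFactorial p q n / pqFactorial p q (n - k))) *
        ∏ i ∈ Finset.range (n - k), (C (p ^ i * a) - C (q ^ i) * (C (q ^ k) * X)) := by
  induction k with
  | zero =>
    have hfac : pqFactorial p q n ≠ 0 := by
      refine Finset.prod_ne_zero_iff.mpr fun j hj => ?_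
      have hj := Finset.mem_range.mp hj
      exact pqNum_ne_zero (by simpa using hpq 1 le_rfl (by omega)) (hpq _ (by omega) (by omega))
    simp [div_self hfac]
  | succ k ih =>
    obtain ⟨m, rfl⟩ : ∃ m, n = m + 1 + k := ⟨n - (k + 1), by omega⟩
    have hnum : pqNum p q (m + 1) ≠ 0 :=
      pqNum_ne_zero (by simpa using hpq 1 le_rfl (by omega)) (hpq _ (by omega) (by omega))
    have hexp : (k + 1) * (k + 1 - 1) / 2 = k * (k - 1) / 2 + k := by
      simpa only [Finset.sum_range_id_mul_two, Finset.sum_range_id] using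
        Finset.sum_range_succ (fun i => i) k
    have hfac : pqFactorial p q (m + 1) = pqFactorial p q m * pqNum p q (m + 1) :=
      Finset.prod_range_succ _ _
    rw [Function.iterate_succ_apply', ih (by omega), pqDeriv_C_mul,
      show m + 1 + k - k = m + 1 by omega, show m + 1 + k - (k + 1) = m by omega,
      pqDeriv_prod_succ, ← mul_assoc, ← C_mul, ← pow_succ, hexp, hfac]
    congr 2
    rw [div_mul_eq_div_div, pow_add q, pow_succ (-1)]
    field_simp
end
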